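/- arXiv:math/0008234 — 2 statements merged into one kernel-verified Lean document; each statement's English description precedes it below -/
import Mathlib

section
/- Let W be a real-linear subspace of the space of ℝ-linear maps ℂ → ℂ with dim_ℝ W = 2, and suppose that every nonzero element of W is an orientation-preserving isomorphism, i.e. has positive determinant as an ℝ-linear endomorphism of ℂ ≅ ℝ². Then there exists a unique pair (J₁, J₂) of positive complex structures on ℂ such that W = {A : ℂ →ₗ[ℝ] ℂ | A ∘ J₁ = J₂ ∘ A}, i.e. W is exactly the set of maps that are complex-linear from (ℂ, J₁) to (ℂ, J₂). -/
/-- A positive complex structure on `ℂ` viewed as an oriented 2-dimensional real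
vector space: an `ℝ`-linear map `J` with `J ∘ J = -id` such that for every `v ≠ 0`
the real basis `(v, J v)` is positively oriented. -/
def IsPosComplexStructure (J : ℂ →ₗ[ℝ] ℂ) : Prop :=
  J ∘ₗ J = -LinearMap.id ∧
    ∀ v : ℂ, v ≠ 0 → 0 < v.re * (J v).im - v.im * (J v).re

open Complex in
/-- An `ℝ`-linear map on `ℂ` is determined by its values at `1` and `I`. -/
theorem Complex.linearMap_apply_eq_re_smul_add_im_smul (A : ℂ →ₗ[ℝ] ℂ) (z : ℂ) :
    A z = z.re • A 1 + z.im • A I := by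
  conv_lhs => rw [show z = z.re • (1 : ℂ) + z.im • I by simp]
  rw [map_add, map_smul, map_smul]

open Complex in
/-- The determinant of an `ℝ`-linear endomorphism of `ℂ` in terms of the basis `(1, I)`. -/
theorem Complex.linearMap_det_eq (A : ℂ →ₗ[ℝ] ℂ) :
    LinearMap.det A = (A 1).re * (A I).im - (A 1).im * (A I).re := by
  rw [← LinearMap.det_toMatrix basisOneI, Matrix.det_fin_two]
  simp [LinearMap.toMatrix_apply]
  ring

/-- The `ℝ`-linear map `ℂ → ℂ` sending `1` to `u` and `I` to `v`. -/
noncomputable def Complex.linearMapOfOneI (u v : ℂ) : ℂ →ₗ[ℝ] ℂ :=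
  Complex.reLm.smulRight u + Complex.imLm.smulRight v

/-- A linear map whose area form `v ↦ v ∧ T v` is positive becomes a complex structure after a
unique affine change `p + q T` with `q > 0`. -/
theorem exists_unique_smul_id_add_smul_sq_eq_neg_id (T : ℂ →ₗ[ℝ] ℂ)
    (hT : ∀ z : ℂ, z ≠ 0 → 0 < z.re * (T z).im - z.im * (T z).re) :
    ∃! p : ℝ × ℝ, 0 < p.2 ∧
      ∀ z, p.1 • (p.1 • z + p.2 • T z) + p.2 • T (p.1 • z + p.2 • T z) = -z := by
  obtain ⟨a, ha⟩ : ∃ a, a = (T 1).re := ⟨_, rfl⟩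
  obtain ⟨b, hb⟩ : ∃ b, b = (T 1).im := ⟨_, rfl⟩
  obtain ⟨c, hc⟩ : ∃ c, c = (T Complex.I).re := ⟨_, rfl⟩
  obtain ⟨d, hd⟩ : ∃ d, d = (T Complex.I).im := ⟨_, rfl⟩
  have hre (z : ℂ) : (T z).re = z.re * a + z.im * c := by
    rw [Complex.linearMap_apply_eq_re_smul_add_im_smul T z]; simp [ha, hc]
  have him (z : ℂ) : (T z).im = z.re * b + z.im * d := by
    rw [Complex.linearMap_apply_eq_re_smul_add_im_smul T z]; simp [hb, hd]
  have hb0 : 0 < b := by simpa [hb] using hT 1 one_ne_zero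
  have hdisc : 0 < -4 * b * c - (a - d) ^ 2 := by
    have h := hT ⟨a - d, 2 * b⟩ fun h => by
      have := congrArg Complex.im h
      simp at this
      exact hb0.ne' this
    rw [hre, him] at h
    simp only at h
    refine pos_of_mul_pos_right (a := b) ?_ hb0.le
    linarith
  obtain ⟨s, hs, hs2⟩ : ∃ s : ℝ, 0 < s ∧ s ^ 2 = -4 * b * c - (a - d) ^ 2 :=
    ⟨_, Real.sqrt_pos.2 hdisc, Real.sq_sqrt hdisc.le⟩
  refine ⟨(-(a + d) / s, 2 / s), ⟨by positivity, fun z => ?_⟩, ?_⟩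
  · apply Complex.ext
    · simp [hre, him]
      field_simp
      linear_combination z.re * hs2
    · simp [hre, him]
      field_simp
      linear_combination z.im * hs2
  · rintro ⟨p, q⟩ ⟨hq, h⟩
    have h1 := congrArg Complex.re (h 1)
    have h2 := congrArg Complex.im (h 1)
    simp [hre, him] at hq h1 h2
    have hp : 2 * p + q * (a + d) = 0 := by
      have : q * b ≠ 0 := by positivity
      apply mul_left_cancel₀ this
      linear_combination h2
    have hqs : q * s = 2 := by
      have : (q * s) ^ 2 = 2 ^ 2 := by
        linear_combination q ^ 2 * hs2 - 4 * h1 + (2 * p + q * (3 * a - d)) * hp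
      exact (sq_eq_sq₀ (by positivity) (by norm_num)).1 this
    have hq' : q = 2 / s := by field_simp; exact hqs
    refine Prod.ext ?_ hq'
    change p = _
    field_simp
    linear_combination s / 2 * hp - (a + d) / 2 * hqs

/-- A two-dimensional space of endomorphisms with positive determinant consists of the maps whose
value at `I` depends on the value at `1` through a fixed linear map with positive area form. -/
theorem exists_mem_iff_apply_I_eq (W : Submodule ℝ (ℂ →ₗ[ℝ] ℂ)) (hdim : Module.finrank ℝ W = 2)
    (hpos : ∀ A ∈ W, A ≠ 0 → 0 < LinearMap.det A) :
    ∃ T : ℂ →ₗ[ℝ] ℂ, (∀ A, A ∈ W ↔ A Complex.I = T (A 1)) ∧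
      ∀ z : ℂ, z ≠ 0 → 0 < z.re * (T z).im - z.im * (T z).re := by
  let ev : W →ₗ[ℝ] ℂ := (LinearMap.applyₗ (1 : ℂ)).comp W.subtype
  have hinj : Function.Injective ev := by
    rw [injective_iff_map_eq_zero]
    intro A hA
    by_contra h
    have hA1 : (A : ℂ →ₗ[ℝ] ℂ) 1 = 0 := hA
    have := hpos A A.2 (by simpa using h)
    simp [Complex.linearMap_det_eq, hA1] at this
  have : FiniteDimensional ℝ W := Module.finite_of_finrank_pos (by omega)
  let e : W ≃ₗ[ℝ] ℂ := LinearEquiv.ofInjectiveOfFinrankEq ev hinj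
    (by rw [hdim, Complex.finrank_real_complex])
  have he (A : W) : e A = (A : ℂ →ₗ[ℝ] ℂ) 1 := rfl
  have he1 (z : ℂ) : (e.symm z : ℂ →ₗ[ℝ] ℂ) 1 = z := by rw [← he, e.apply_symm_apply]
  let T : ℂ →ₗ[ℝ] ℂ :=
    (LinearMap.applyₗ Complex.I).comp (W.subtype.comp e.symm.toLinearMap)
  have hTz (z : ℂ) : T z = (e.symm z : ℂ →ₗ[ℝ] ℂ) Complex.I := rfl
  refine ⟨T, fun A => ⟨fun hA => ?_, fun hA => ?_⟩, fun z hz => ?_⟩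
  · rw [hTz, ← he ⟨A, hA⟩, e.symm_apply_apply]
  · have : A = e.symm (A 1) := by
      ext z
      rw [Complex.linearMap_apply_eq_re_smul_add_im_smul A,
        Complex.linearMap_apply_eq_re_smul_add_im_smul (e.symm (A 1) : ℂ →ₗ[ℝ] ℂ),
        he1, ← hTz, hA]
    rw [this]
    exact (e.symm (A 1)).2
  · have h := hpos _ (e.symm z).2 (by simpa using hz)
    rwa [Complex.linearMap_det_eq, he1, ← hTz] at h

/-- A linear map intertwines two complex structures as soon as it does so at the vector `1`. -/
theorem comp_eq_comp_iff_apply_one {J K : ℂ →ₗ[ℝ] ℂ} (hJ : IsPosComplexStructure J)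
    (hK : IsPosComplexStructure K) (A : ℂ →ₗ[ℝ] ℂ) :
    A ∘ₗ J = K ∘ₗ A ↔ A (J 1) = K (A 1) := by
  refine ⟨fun h => LinearMap.congr_fun h 1, fun h => ?_⟩
  have hJJ : J (J 1) = -1 := LinearMap.congr_fun hJ.1 1
  have hKK (z : ℂ) : K (K z) = -z := LinearMap.congr_fun hK.1 z
  have hq : (J 1).im ≠ 0 := by simpa using (hJ.2 1 one_ne_zero).ne'
  have hJ1 := Complex.linearMap_apply_eq_re_smul_add_im_smul LinearMap.id (J 1)
  simp only [LinearMap.id_apply] at hJ1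
  have hI : A (J Complex.I) = K (A Complex.I) := by
    have h1 : A (J (J 1)) = K (A (J 1)) := by rw [hJJ, h, hKK, map_neg]
    rw [hJ1] at h1
    simp only [map_add, map_smul, h, add_right_inj] at h1
    exact smul_right_injective ℂ hq h1
  ext z
  rw [Complex.linearMap_apply_eq_re_smul_add_im_smul (A ∘ₗ J),
    Complex.linearMap_apply_eq_re_smul_add_im_smul (K ∘ₗ A)]
  simp only [LinearMap.comp_apply, h, hI]

/-- A positive complex structure is determined by its value at `1`. -/
theorem IsPosComplexStructure.ext_apply_one {J K : ℂ →ₗ[ℝ] ℂ} (hJ : IsPosComplexStructure J)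
    (hK : IsPosComplexStructure K) (h : J 1 = K 1) : J = K :=
  (comp_eq_comp_iff_apply_one hJ hK LinearMap.id).2 h

/-- Every `w` in the upper half plane is the value at `1` of a positive complex structure. -/
theorem exists_isPosComplexStructure_apply_one {w : ℂ} (hw : 0 < w.im) :
    ∃ J : ℂ →ₗ[ℝ] ℂ, IsPosComplexStructure J ∧ J 1 = w := by
  let J := Complex.linearMapOfOneI w ((-w.im⁻¹) • (1 + w.re • w))
  have hJ (z : ℂ) : J z = z.re • w + z.im • (-w.im⁻¹) • (1 + w.re • w) := rfl
  refine ⟨J, ⟨?_, fun z hz => ?_⟩, by simp [hJ]⟩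
  · ext z
    rw [LinearMap.comp_apply, hJ, hJ]
    apply Complex.ext <;> simp <;> field_simp <;> ring
  · have key : z.re * (J z).im - z.im * (J z).re =
        ((w.im * z.re - w.re * z.im) ^ 2 + z.im ^ 2) / w.im := by
      simp [hJ]; field_simp; ring
    rw [key]
    refine div_pos ?_ hw
    by_cases h : z.im = 0
    · have : z.re ≠ 0 := fun h' => hz (Complex.ext h' h)
      simp only [h, mul_zero, sub_zero, ne_eq, OfNat.ofNat_ne_zero, not_false_eq_true, zero_pow,
        add_zero]
      positivity
    · positivity

/-- Section 1.A: if `W` is a 2-dimensional real subspace of the `ℝ`-linear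
endomorphisms of `ℂ` all of whose nonzero elements are orientation-preserving
isomorphisms (positive determinant), then there is a unique pair `(J₁, J₂)` of
positive complex structures on `ℂ` such that `W` is exactly the space of maps
that are complex-linear from `(ℂ, J₁)` to `(ℂ, J₂)`. -/
theorem exists_unique_complex_structures
    (W : Submodule ℝ (ℂ →ₗ[ℝ] ℂ)) (hdim : Module.finrank ℝ W = 2)
    (hpos : ∀ A ∈ W, A ≠ 0 → 0 < LinearMap.det A) :
    ∃! p : (ℂ →ₗ[ℝ] ℂ) × (ℂ →ₗ[ℝ] ℂ),
      IsPosComplexStructure p.1 ∧ IsPosComplexStructure p.2 ∧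
        (W : Set (ℂ →ₗ[ℝ] ℂ)) = {A : ℂ →ₗ[ℝ] ℂ | A ∘ₗ p.1 = p.2 ∘ₗ A} := by
  obtain ⟨T, hW, hT⟩ := exists_mem_iff_apply_I_eq W hdim hpos
  obtain ⟨⟨p, q⟩, ⟨hq, hpq⟩, huniq⟩ := exists_unique_smul_id_add_smul_sq_eq_neg_id T hT
  simp only at hq hpq
  have apply_J (A J : ℂ →ₗ[ℝ] ℂ) : A (J 1) = (J 1).re • A 1 + (J 1).im • A Complex.I :=
    Complex.linearMap_apply_eq_re_smul_add_im_smul A (J 1)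
  obtain ⟨J, hJ, hJ1⟩ := exists_isPosComplexStructure_apply_one (w := ⟨p, q⟩) hq
  let K : ℂ →ₗ[ℝ] ℂ := p • LinearMap.id + q • T
  have hKz (z : ℂ) : K z = p • z + q • T z := rfl
  have hK : IsPosComplexStructure K := by
    refine ⟨LinearMap.ext hpq, fun z hz => ?_⟩
    have := mul_pos hq (hT z hz)
    simp only [hKz, Complex.add_re, Complex.add_im, Complex.smul_re, Complex.smul_im, smul_eq_mul]
    linarith
  refine ⟨(J, K), ⟨hJ, hK, ?_⟩, ?_⟩
  · ext A
    rw [SetLike.mem_coe, hW, Set.mem_ofPred_eq, comp_eq_comp_iff_apply_one hJ hK, apply_J A J,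
      hJ1, hKz, add_right_inj]
    exact (smul_right_injective ℂ hq.ne').eq_iff.symm
  · rintro ⟨J', K'⟩ ⟨hJ', hK', hW'⟩
    simp only at hJ' hK' hW'
    have hK'z (z : ℂ) : K' z = (J' 1).re • z + (J' 1).im • T z := by
      let A := Complex.linearMapOfOneI z (T z)
      have hA1 : A 1 = z := by simp [A, Complex.linearMapOfOneI]
      have hAI : A Complex.I = T z := by simp [A, Complex.linearMapOfOneI]
      have hA : A ∈ (W : Set (ℂ →ₗ[ℝ] ℂ)) := (hW A).2 (by rw [hA1, hAI])
      rw [hW'] at hA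
      have := (comp_eq_comp_iff_apply_one hJ' hK' A).1 hA
      rw [apply_J A J', hA1, hAI] at this
      exact this.symm
    have hJ'1 : ((J' 1).re, (J' 1).im) = (p, q) := by
      refine huniq _ ⟨by simpa using hJ'.2 1 one_ne_zero, fun z => ?_⟩
      simp only [← hK'z]
      exact LinearMap.congr_fun hK'.1 z
    rw [Prod.mk.injEq] at hJ'1
    refine Prod.ext (hJ'.ext_apply_one hJ ?_) (LinearMap.ext fun z => ?_)
    · rw [hJ1]
      exact Complex.ext hJ'1.1 hJ'1.2
    · change K' z = K z
      rw [hK'z, hKz, hJ'1.1, hJ'1.2]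
end

section
/- Let S be the unit sphere centered at 0 in EuclideanSpace ℝ (Fin 3), and let b : S → S be a map such that dist(b(u), b(v)) < dist(u, v) for all u ≠ v in S. Then there exists a unique u ∈ S such that b(u) = −u (as vectors in EuclideanSpace ℝ (Fin 3)). -/
/-- Edelstein's theorem: a strictly distance-decreasing self-map of a nonempty compact metric space
has a unique fixed point. -/
theorem existsUnique_isFixedPt_of_dist_lt {X : Type*} [MetricSpace X] [CompactSpace X] [Nonempty X]
    {f : X → X} (hf : ∀ x y, x ≠ y → dist (f x) (f y) < dist x y) :
    ∃! x, Function.IsFixedPt f x := by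
  have hcont : Continuous f := by
    refine (LipschitzWith.of_dist_le_mul (K := 1) fun x y => ?_).continuous
    rcases eq_or_ne x y with rfl | h
    · simp
    · simpa using (hf x y h).le
  obtain ⟨x, -, hx⟩ := isCompact_univ.exists_isMinOn Set.univ_nonempty
    (continuous_id.dist hcont).continuousOn
  have hfix : Function.IsFixedPt f x := by
    by_contra h
    exact (hf x (f x) (Ne.symm h)).not_ge (hx (Set.mem_univ (f x)))
  refine ⟨x, hfix, fun y hy => ?_⟩
  by_contra h
  have hlt := hf y x h
  rw [hy.eq, hfix.eq] at hlt
  exact hlt.false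


/-- Section 1.C: if `b` is a strict contraction of the unit 2-sphere, then there is a
unique point `u` of the sphere with `b u = -u`. -/
theorem exists_unique_antipodal_fixed_point
    (b : Metric.sphere (0 : EuclideanSpace ℝ (Fin 3)) 1 →
         Metric.sphere (0 : EuclideanSpace ℝ (Fin 3)) 1)
    (hb : ∀ u v : Metric.sphere (0 : EuclideanSpace ℝ (Fin 3)) 1,
      u ≠ v → dist (b u) (b v) < dist u v) :
    ∃! u : Metric.sphere (0 : EuclideanSpace ℝ (Fin 3)) 1,
      (b u : EuclideanSpace ℝ (Fin 3)) = -(u : EuclideanSpace ℝ (Fin 3)) := by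
  have : Nonempty (Metric.sphere (0 : EuclideanSpace ℝ (Fin 3)) 1) :=
    (NormedSpace.sphere_nonempty.2 zero_le_one).to_subtype
  have hneg : ∀ u v : Metric.sphere (0 : EuclideanSpace ℝ (Fin 3)) 1,
      u ≠ v → dist (-b u) (-b v) < dist u v := fun u v h => by
    simpa [Subtype.dist_eq, dist_neg_neg] using hb u v h
  refine (existsUnique_congr fun u => ?_).1 (existsUnique_isFixedPt_of_dist_lt hneg)
  rw [Function.IsFixedPt, neg_eq_iff_eq_neg, Subtype.ext_iff, coe_neg_sphere]
end
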